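/- arXiv:1002.0056 — 2 statements merged into one kernel-verified Lean document; each statement's English description precedes it below -/
import Mathlib

section
/- Let k be a natural number. For every real x, the limit as d → ∞ of (d/12)^((k+1)/2) · B_d^(k)(√(d/12)·x + d/2) equals (1/√(2π)) · g^(k)(x), where B_d^(k) denotes the k-th derivative of the cardinal B-spline of order d and g^(k) denotes the k-th derivative of the Gaussian g(x) = exp(−x²/2). -/
open MeasureTheory Real Filter Finset

/-- The cardinal B-spline of order `d`: `B_1` is the indicator of `[0,1)`,
and `B_d = B_1 * B_{d-1}` (convolution) for `d ≥ 2`. -/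
noncomputable def Bspline : ℕ → ℝ → ℝ
  | 0, _ => 0
  | 1, x => if 0 ≤ x ∧ x < 1 then 1 else 0
  | (d + 2), x => ∫ y : ℝ, (if 0 ≤ x - y ∧ x - y < 1 then (1 : ℝ) else 0) * Bspline (d + 1) y

lemma sinc_sq_le (v : ℝ) : sinc v ^ 2 * (1 + v ^ 2 / 4) ≤ 1 := by
  by_cases h : |v| ≤ 2
  · have hv := abs_le.mp h
    have hpi := Real.pi_gt_three
    have h1 := cos_le_one_div_sqrt_sq_add_one (x := v / 2) (by linarith) (by linarith)
    have h0 : 0 ≤ cos (v / 2) := cos_nonneg_of_mem_Icc ⟨by linarith, by linarith⟩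
    have hs : sinc v = cos (v / 2) * sinc (v / 2) := by
      by_cases hz : v = 0
      · simp [hz]
      have hz2 : v / 2 ≠ 0 := by simpa using hz
      rw [sinc_of_ne_zero hz, sinc_of_ne_zero hz2]
      have : sin v = 2 * sin (v / 2) * cos (v / 2) := by rw [← sin_two_mul]; congr 1; ring
      rw [this]; field_simp
    have h2 : sinc (v / 2) ^ 2 ≤ 1 := by
      rw [sq_le_one_iff_abs_le_one]; exact abs_sinc_le_one _
    have h3 : cos (v / 2) ^ 2 * (1 + v ^ 2 / 4) ≤ 1 := by
      have : cos (v / 2) ^ 2 ≤ (1 / √((v / 2) ^ 2 + 1)) ^ 2 := by gcongr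
      rw [div_pow, sq_sqrt (by positivity), one_pow, le_div_iff₀ (by positivity)] at this
      nlinarith
    rw [hs, mul_pow]
    have h4 : 0 ≤ cos (v / 2) ^ 2 * (1 + v ^ 2 / 4) := by positivity
    nlinarith [mul_le_mul h3 h2 (sq_nonneg _) zero_le_one]
  · push Not at h
    have hz : v ≠ 0 := by rintro rfl; simp at h; linarith
    rw [sinc_of_ne_zero hz, div_pow, div_mul_eq_mul_div, div_le_one (by positivity)]
    have h1 : sin v ^ 2 ≤ 1 := by rw [sq_le_one_iff_abs_le_one]; exact abs_sin_le_one v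
    have h2 : 4 < v ^ 2 := by rw [← sq_abs]; nlinarith
    nlinarith [mul_le_mul_of_nonneg_right h1 (by positivity : (0:ℝ) ≤ 1 + v ^ 2 / 4)]

/-- a crude uniform decay estimate -/
lemma sinc_pow_bound (n d : ℕ) (hn : 1 ≤ n) (hd : 2 * n ≤ d) (v : ℝ) :
    |sinc v ^ d| * (1 + v ^ 2 / 4 * (d / (2 * n))) ^ n ≤ 1 := by
  have hn0 : (0 : ℝ) < n := by exact_mod_cast hn
  have hp : (1 : ℝ) ≤ d / (2 * n) := by
    rw [le_div_iff₀ (by positivity), one_mul]; exact_mod_cast hd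
  have hA : (0 : ℝ) ≤ v ^ 2 / 4 := by positivity
  have hb := one_add_mul_self_le_rpow_one_add (s := v ^ 2 / 4) (by linarith) hp
  have hpos : (0 : ℝ) ≤ 1 + v ^ 2 / 4 := by linarith
  have h1 : ((1 + v ^ 2 / 4 * (d / (2 * n))) ^ n) ^ 2 ≤ (1 + v ^ 2 / 4) ^ d := by
    calc ((1 + v ^ 2 / 4 * (d / (2 * n))) ^ n) ^ 2
        ≤ (((1 + v ^ 2 / 4) ^ ((d : ℝ) / (2 * n))) ^ n) ^ 2 := by
          gcongr; linarith
      _ = (1 + v ^ 2 / 4) ^ d := by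
          generalize 1 + v ^ 2 / 4 = X at hpos
          rw [← pow_mul, ← rpow_natCast, ← rpow_mul hpos, ← rpow_natCast]
          congr 1; push_cast; field_simp
  have h2 : (sinc v ^ d) ^ 2 * (1 + v ^ 2 / 4) ^ d ≤ 1 := by
    rw [← pow_mul, mul_comm d 2, pow_mul, ← mul_pow]
    exact pow_le_one₀ (by positivity) (sinc_sq_le v)
  rw [← abs_of_nonneg (by positivity : (0 : ℝ) ≤ (1 + v ^ 2 / 4 * (d / (2 * n))) ^ n), ← abs_mul,
    ← sq_le_one_iff_abs_le_one, mul_pow]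
  exact (mul_le_mul_of_nonneg_left h1 (sq_nonneg _)).trans h2

lemma tendsto_sinc_pow (u : ℝ) :
    Tendsto (fun d : ℕ => sinc (u / (2 * √((d : ℝ) / 12))) ^ d) atTop
      (nhds (exp (-(u ^ 2) / 2))) := by
  set v : ℕ → ℝ := fun d => u / (2 * √((d : ℝ) / 12)) with hv
  have hv0 : Tendsto v atTop (nhds 0) := by
    refine Tendsto.div_atTop tendsto_const_nhds ?_
    refine Tendsto.const_mul_atTop two_pos ?_
    exact tendsto_sqrt_atTop.comp (tendsto_natCast_atTop_atTop.atTop_div_const (by norm_num))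
  have hv2 : ∀ d : ℕ, 0 < d → d * v d ^ 2 = 3 * u ^ 2 := by
    intro d hd
    have : (0 : ℝ) < d := by exact_mod_cast hd
    simp only [hv]
    rw [div_pow, mul_pow, sq_sqrt (by positivity)]
    field_simp; ring
  have key : Tendsto (fun d : ℕ => (d : ℝ) * (sinc (v d) - 1)) atTop (nhds (-(u ^ 2) / 2)) := by
    rw [tendsto_iff_norm_sub_tendsto_zero]
    have hlim : Tendsto (fun d => 3 * u ^ 2 * v d ^ 2 / 100) atTop (nhds 0) := by
      have := ((hv0.pow 2).const_mul (3 * u ^ 2)).div_const 100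
      simpa using this
    refine squeeze_zero' (Eventually.of_forall fun _ => norm_nonneg _) ?_ hlim
    have h1 : ∀ᶠ d in atTop, |v d| ≤ 1 := by
      have := hv0.abs.eventually (gt_mem_nhds (by rw [abs_zero]; exact one_pos : |(0 : ℝ)| < 1))
      exact this.mono fun _ h => h.le
    filter_upwards [h1, eventually_gt_atTop 0] with d hd hdp
    have h2 := hv2 d hdp
    have hs : |sinc (v d) - 1 + v d ^ 2 / 6| ≤ v d ^ 4 / 100 := by
      by_cases hz : v d = 0
      · simp [hz]
      have hb := Real.sin_bound hd
      have e : sin (v d) - (v d - v d ^ 3 / 6) = v d * (sinc (v d) - 1 + v d ^ 2 / 6) := by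
        rw [sinc_of_ne_zero hz]; field_simp; ring
      rw [e, abs_mul] at hb
      have hp : 0 < |v d| := abs_pos.mpr hz
      have e2 : |v d| ^ 5 / 100 = |v d| * (v d ^ 4 / 100) := by
        rw [← Even.pow_abs (n := 4) (by decide)]; ring
      rw [e2] at hb
      exact le_of_mul_le_mul_left hb hp
    rw [Real.norm_eq_abs]
    have e3 : (d : ℝ) * (sinc (v d) - 1) - -(u ^ 2) / 2
        = d * (sinc (v d) - 1 + v d ^ 2 / 6) := by
      have : (d : ℝ) * (v d ^ 2 / 6) = u ^ 2 / 2 := by rw [← mul_div_assoc, h2]; ring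
      rw [mul_add, this]; ring
    rw [e3, abs_mul, Nat.abs_cast, ← h2]
    calc (d : ℝ) * _ ≤ d * (v d ^ 4 / 100) := by gcongr
      _ = _ := by ring
  have := Real.tendsto_one_add_pow_exp_of_tendsto key
  simpa only [add_sub_cancel] using this
lemma weight_integrable {h : ℝ → ℝ} {k : ℕ} {C : ℝ}
    (hb : ∀ u, |h u| * (1 + u ^ 2) ^ (k + 1) ≤ C) (j : ℕ) (hj : j ≤ k) :
    Integrable (fun u => C * (1 + u ^ 2)⁻¹) ∧ ∀ u, |u| ^ j * |h u| ≤ C * (1 + u ^ 2)⁻¹ := by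
  refine ⟨integrable_inv_one_add_sq.const_mul C, fun u => ?_⟩
  have h1 : |u| ≤ 1 + u ^ 2 := by rw [← sq_abs]; nlinarith [abs_nonneg u, sq_nonneg (|u| - 1)]
  have h2 : |u| ^ j ≤ (1 + u ^ 2) ^ k :=
    (pow_le_pow_left₀ (abs_nonneg _) h1 j).trans
      (pow_le_pow_right₀ (by nlinarith [sq_nonneg u]) hj)
  rw [← div_eq_mul_inv, le_div_iff₀ (by positivity)]
  refine le_trans ?_ (hb u)
  rw [pow_succ]
  calc |u| ^ j * |h u| * (1 + u ^ 2) ≤ (1 + u ^ 2) ^ k * |h u| * (1 + u ^ 2) := by gcongr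
    _ = _ := by ring

lemma iteratedDeriv_cosInt {h : ℝ → ℝ} (hc : Continuous h) {k : ℕ} {C : ℝ}
    (hb : ∀ u, |h u| * (1 + u ^ 2) ^ (k + 1) ≤ C) (c : ℝ) (j : ℕ) (hj : j ≤ k) :
    iteratedDeriv j (fun x => ∫ t : ℝ, cos (t * (x - c)) * h t)
      = fun x => ∫ t : ℝ, t ^ j * cos (t * (x - c) + j * (π / 2)) * h t := by
  induction j with
  | zero => simp
  | succ j ih =>
    rw [iteratedDeriv_succ, ih (by omega)]
    funext x
    obtain ⟨hI, hB⟩ := weight_integrable hb j (by omega)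
    obtain ⟨-, hB'⟩ := weight_integrable hb (j + 1) hj
    refine (hasDerivAt_integral_of_dominated_loc_of_deriv_le (s := Set.univ)
      (bound := fun u => C * (1 + u ^ 2)⁻¹)
      (F := fun x t => t ^ j * cos (t * (x - c) + j * (π / 2)) * h t)
      (F' := fun x t => t ^ (j + 1) * cos (t * (x - c) + (j + 1 : ℕ) * (π / 2)) * h t)
      Filter.univ_mem ?_ ?_ ?_ ?_ hI ?_).2.deriv
    · exact Eventually.of_forall fun x =>
        (by fun_prop : Continuous _).aestronglyMeasurable
    · refine hI.mono' (by fun_prop : Continuous _).aestronglyMeasurable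
        (Eventually.of_forall fun t => ?_)
      refine le_trans ?_ (hB t)
      rw [norm_mul, norm_mul, norm_pow]
      simp only [Real.norm_eq_abs]
      gcongr
      exact mul_le_of_le_one_right (by positivity) (abs_cos_le_one _)
    · exact (by fun_prop : Continuous _).aestronglyMeasurable
    · refine Eventually.of_forall fun t x _ => ?_
      refine le_trans ?_ (hB' t)
      rw [norm_mul, norm_mul, norm_pow]
      simp only [Real.norm_eq_abs]
      gcongr
      exact mul_le_of_le_one_right (by positivity) (abs_cos_le_one _)
    · refine Eventually.of_forall fun t x _ => ?_
      have h1 : HasDerivAt (fun x : ℝ => t * (x - c) + j * (π / 2)) t x := by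
        simpa using (((hasDerivAt_id x).sub_const c).const_mul t).add_const (j * (π / 2))
      have h2 := ((h1.cos).const_mul (t ^ j)).mul_const (h t)
      convert! h2 using 1
      have : t * (x - c) + ((j + 1 : ℕ) : ℝ) * (π / 2)
          = (t * (x - c) + j * (π / 2)) + π / 2 := by push_cast; ring
      rw [this, cos_add_pi_div_two]; ring

lemma gauss_cosInt (x : ℝ) :
    ∫ t : ℝ, cos (t * (x - 0)) * exp (-(t ^ 2) / 2) = √(2 * π) * exp (-(x ^ 2) / 2) := by
  have h := fourierIntegral_gaussian (b := 1 / 2) (by norm_num) (x : ℂ)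
  have hint : Integrable (fun t : ℝ => Complex.exp (Complex.I * x * t) *
      Complex.exp (-(1 / 2) * (t : ℂ) ^ 2)) := by
    have hg : Integrable (fun t : ℝ => exp (-(1 / 2) * t ^ 2)) :=
      integrable_exp_neg_mul_sq (by norm_num)
    refine hg.mono' (by fun_prop : Continuous _).aestronglyMeasurable
      (Eventually.of_forall fun t => ?_)
    rw [norm_mul, Complex.norm_exp, Complex.norm_exp]
    simp [← Complex.ofReal_pow]
  have h2 := congrArg Complex.re h
  have h3 := integral_re hint
  simp only [RCLike.re_to_complex] at h3
  rw [← h3] at h2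
  have e1 : ∀ t : ℝ, (Complex.exp (Complex.I * x * t) *
      Complex.exp (-(1 / 2) * (t : ℂ) ^ 2)).re = cos (t * (x - 0)) * exp (-(t ^ 2) / 2) := by
    intro t
    have a1 : Complex.exp (-(1 / 2) * (t : ℂ) ^ 2) = ((exp (-(t ^ 2) / 2) : ℝ) : ℂ) := by
      push_cast; congr 1; ring
    have a2 : Complex.I * x * t = ((t * x : ℝ) : ℂ) * Complex.I := by push_cast; ring
    rw [a1, a2, Complex.re_mul_ofReal, Complex.exp_ofReal_mul_I_re, sub_zero]
  simp_rw [e1] at h2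
  rw [h2]
  have a3 : ((π : ℂ) / (1 / 2)) ^ (1 / 2 : ℂ) = ((√(2 * π) : ℝ) : ℂ) := by
    rw [sqrt_eq_rpow, Complex.ofReal_cpow (by positivity)]
    push_cast; congr 1; ring
  have a4 : Complex.exp (-(x : ℂ) ^ 2 / (4 * (1 / 2))) = ((exp (-(x ^ 2) / 2) : ℝ) : ℂ) := by
    push_cast; congr 1; ring
  rw [a3, a4, ← Complex.ofReal_mul, Complex.ofReal_re]
lemma Bspline_succ (n : ℕ) (x : ℝ) :
    Bspline (n + 2) x = ∫ y in (x - 1)..x, Bspline (n + 1) y := by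
  rw [Bspline, intervalIntegral.integral_of_le (by linarith),
    ← integral_indicator measurableSet_Ioc]
  congr 1
  funext y
  by_cases h : y ∈ Set.Ioc (x - 1) x
  · rw [Set.indicator_of_mem h, if_pos ⟨by linarith [h.2], by linarith [h.1]⟩, one_mul]
  · rw [Set.indicator_of_notMem h, if_neg, zero_mul]
    rintro ⟨h1, h2⟩
    exact h ⟨by linarith, by linarith⟩

lemma Bspline_one_eq : Bspline 1 = Set.indicator (Set.Ico 0 1) (fun _ => (1 : ℝ)) := by
  funext x
  rw [Bspline, Set.indicator_apply]
  rfl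

lemma Bspline_one_integrable : Integrable (Bspline 1) := by
  rw [Bspline_one_eq, integrable_indicator_iff measurableSet_Ico]
  simp

lemma Bspline_two_continuous : Continuous (Bspline 2) := by
  have hi : ∀ a b, IntervalIntegrable (Bspline 1) volume a b :=
    fun a b => Bspline_one_integrable.intervalIntegrable
  have hp := intervalIntegral.continuous_primitive hi 0
  have : Bspline 2 = fun x => (∫ y in (0 : ℝ)..x, Bspline 1 y) - ∫ y in (0 : ℝ)..(x - 1), Bspline 1 y := by
    funext x
    rw [Bspline_succ 0 x, intervalIntegral.integral_interval_sub_left (hi _ _) (hi _ _)]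
  rw [this]
  exact hp.sub (hp.comp (by fun_prop : Continuous fun x : ℝ => x - 1))

open scoped FourierTransform Convolution

lemma fourier_Bspline_one (w : ℝ) :
    𝓕 (fun x => (Bspline 1 x : ℂ)) w
      = Complex.exp (((-(π * w) : ℝ) : ℂ) * Complex.I) * (sinc (π * w) : ℝ) := by
  rw [Real.fourier_real_eq_integral_exp_smul]
  have e : (fun v : ℝ => Complex.exp (↑(-2 * π * v * w) * Complex.I) • (Bspline 1 v : ℂ))
      = Set.indicator (Set.Ico 0 1) (fun v : ℝ => Complex.exp (v * (((-2 * π * w : ℝ) : ℂ) * Complex.I))) := by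
    funext v
    rw [Bspline_one_eq]
    by_cases h : v ∈ Set.Ico (0 : ℝ) 1
    · rw [Set.indicator_of_mem h, Set.indicator_of_mem h]
      simp only [Complex.ofReal_one, smul_eq_mul, mul_one]
      congr 1; push_cast; ring
    · rw [Set.indicator_of_notMem h, Set.indicator_of_notMem h]
      simp
  rw [e, integral_indicator measurableSet_Ico, integral_Ico_eq_integral_Ioc,
    ← intervalIntegral.integral_of_le zero_le_one]
  by_cases hw : w = 0
  · simp [hw]
  have hpw : π * w ≠ 0 := mul_ne_zero pi_ne_zero hw
  have hc : (((-2 * π * w : ℝ) : ℂ) * Complex.I) ≠ 0 := by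
    refine mul_ne_zero ?_ Complex.I_ne_zero
    rw [Complex.ofReal_ne_zero, mul_assoc]
    exact mul_ne_zero (by norm_num) hpw
  simp_rw [mul_comm _ (((-2 * π * w : ℝ) : ℂ) * Complex.I)]
  rw [integral_exp_mul_complex hc, div_eq_iff hc, sinc_of_ne_zero hpw]
  have e1 : (((-2 * π * w : ℝ) : ℂ) * Complex.I) * ((1 : ℝ) : ℂ)
     = ((-(π * w) : ℝ) : ℂ) * Complex.I + ((-(π * w) : ℝ) : ℂ) * Complex.I := by push_cast; ring
  rw [e1, Complex.exp_add]
  have e2 : Complex.exp (((π * w : ℝ) : ℂ) * Complex.I) *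
      Complex.exp (((-(π * w) : ℝ) : ℂ) * Complex.I) = 1 := by
    rw [← Complex.exp_add]; simp
  have e3 : ((sin (π * w) : ℝ) : ℂ) = (Complex.exp (((-(π * w) : ℝ) : ℂ) * Complex.I)
      - Complex.exp (((π * w : ℝ) : ℂ) * Complex.I)) * Complex.I / 2 := by
    rw [Complex.ofReal_sin, Complex.sin]; push_cast; ring_nf
  rw [Complex.ofReal_div, e3]
  have hpw' : ((π * w : ℝ) : ℂ) ≠ 0 := by exact_mod_cast hpw
  have e4 : ((-2 * π * w : ℝ) : ℂ) = -2 * ((π * w : ℝ) : ℂ) := by push_cast; ring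
  rw [e4]
  generalize ((π * w : ℝ) : ℂ) = A at *
  generalize Complex.exp (((-(π * w) : ℝ) : ℂ) * Complex.I) = E at *
  generalize Complex.exp (A * Complex.I) = F at *
  field_simp
  simp only [mul_zero, Complex.ofReal_zero, neg_zero, Complex.exp_zero, Complex.I_sq]
  linear_combination e2

lemma sinc_integrable_pow (d : ℕ) (hd : 2 ≤ d) : Integrable (fun t : ℝ => sinc (t / 2) ^ d) := by
  refine (integrable_inv_one_add_sq.const_mul 16).mono'
    (by fun_prop : Continuous _).aestronglyMeasurable (Eventually.of_forall fun t => ?_)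
  have h := sinc_pow_bound 1 d le_rfl hd (t / 2)
  rw [Real.norm_eq_abs, ← div_eq_mul_inv, le_div_iff₀ (by positivity)]
  have hd' : (2 : ℝ) ≤ d := by exact_mod_cast hd
  have : (1 + t ^ 2) / 16 ≤ (1 + (t / 2) ^ 2 / 4 * ((d : ℝ) / (2 * (1 : ℕ)))) ^ 1 := by
    push_cast
    nlinarith [mul_le_mul_of_nonneg_left hd' (sq_nonneg t)]
  have := mul_le_mul_of_nonneg_left this (abs_nonneg (sinc (t / 2) ^ d))
  linarith

lemma Bspline_two_eq (x : ℝ) :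
    Bspline 2 x = (1 / (2 * π)) * ∫ t : ℝ, cos (t * (x - 1)) * sinc (t / 2) ^ 2 := by
  set b : ℝ → ℂ := fun x => (Bspline 1 x : ℂ) with hb
  have hbi : Integrable b := Bspline_one_integrable.ofReal
  have hconv : (b ⋆[ContinuousLinearMap.mul ℂ ℂ] b) = fun x => (Bspline 2 x : ℂ) := by
    funext x
    rw [convolution_mul_swap, Bspline, ← integral_complex_ofReal]
    congr 1
    funext y
    simp only [hb, Bspline]
    push_cast
    simp
  have hF : ∀ w, 𝓕 (fun x => (Bspline 2 x : ℂ)) w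
      = Complex.exp (((-(2 * π * w) : ℝ) : ℂ) * Complex.I) * ((sinc (π * w) ^ 2 : ℝ) : ℂ) := by
    intro w
    rw [← hconv, Real.fourier_mul_convolution_eq hbi hbi, fourier_Bspline_one]
    have : ((-(2 * π * w) : ℝ) : ℂ) * Complex.I = ((-(π * w) : ℝ) : ℂ) * Complex.I
      + ((-(π * w) : ℝ) : ℂ) * Complex.I := by push_cast; ring
    rw [this, Complex.exp_add]; push_cast; ring
  have hsi : Integrable (fun w : ℝ => sinc (π * w) ^ 2) := by
    have := (sinc_integrable_pow 2 le_rfl).comp_mul_left' (R := 2 * π) (by positivity)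
    refine this.congr (Eventually.of_forall fun w => ?_)
    simp only
    congr 2; ring
  have hi2 : Integrable (fun x => (Bspline 2 x : ℂ)) := by
    rw [← hconv]; exact hbi.integrable_convolution _ hbi
  have hFi : Integrable (𝓕 (fun x => (Bspline 2 x : ℂ))) := by
    rw [funext hF]
    refine hsi.mono' (by fun_prop : Continuous _).aestronglyMeasurable
      (Eventually.of_forall fun w => ?_)
    rw [norm_mul, Complex.norm_exp_ofReal_mul_I, one_mul, Complex.norm_real, Real.norm_eq_abs, abs_of_nonneg (sq_nonneg _)]
  have hinv := congrFun (Continuous.fourierInv_fourier_eq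
    (Complex.continuous_ofReal.comp Bspline_two_continuous) hi2 hFi) x
  rw [Real.fourierInv_eq'] at hinv
  have hre : ∀ w : ℝ, Complex.exp (((2 * π * inner ℝ w x : ℝ) : ℂ) * Complex.I) •
      𝓕 (fun x => (Bspline 2 x : ℂ)) w =
      Complex.exp (((2 * π * w * (x - 1) : ℝ) : ℂ) * Complex.I) * ((sinc (π * w) ^ 2 : ℝ) : ℂ) := by
    intro w
    rw [hF, smul_eq_mul, ← mul_assoc, ← Complex.exp_add]
    congr 2
    simp only [RCLike.inner_apply, conj_trivial]
    push_cast; ring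
  have hinv' : ∫ w : ℝ, Complex.exp (((2 * π * w * (x - 1) : ℝ) : ℂ) * Complex.I) * ((sinc (π * w) ^ 2 : ℝ) : ℂ) = (Bspline 2 x : ℂ) := by
    refine Eq.trans ?_ hinv; exact integral_congr_ae (Eventually.of_forall fun w => (hre w).symm)
  have hint : Integrable (fun w : ℝ => Complex.exp (((2 * π * w * (x - 1) : ℝ) : ℂ) * Complex.I) * ((sinc (π * w) ^ 2 : ℝ) : ℂ)) := by
    refine hsi.mono' (by fun_prop : Continuous _).aestronglyMeasurable
      (Eventually.of_forall fun w => ?_)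
    rw [norm_mul, Complex.norm_exp_ofReal_mul_I, one_mul, Complex.norm_real, Real.norm_eq_abs, abs_of_nonneg (sq_nonneg _)]
  have h3 := integral_re hint
  simp only [RCLike.re_to_complex] at h3
  rw [hinv', Complex.ofReal_re] at h3
  simp_rw [Complex.re_mul_ofReal, Complex.exp_ofReal_mul_I_re] at h3
  rw [← h3]
  have := Measure.integral_comp_mul_left (fun t : ℝ => cos (t * (x - 1)) * sinc (t / 2) ^ 2) (2 * π)
  rw [abs_of_pos (by positivity), smul_eq_mul, ← one_div] at this
  rw [← this]
  congr 1
  funext w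
  congr 3; ring

lemma integral_cos_shift (t y : ℝ) :
    ∫ s in (y - 1)..y, cos (t * s) = cos (t * (y - 1 / 2)) * sinc (t / 2) := by
  by_cases ht : t = 0
  · simp [ht]
  have ht2 : t / 2 ≠ 0 := by simpa using ht
  rw [intervalIntegral.integral_comp_mul_left (fun s => cos s) ht, integral_cos,
    sinc_of_ne_zero ht2, smul_eq_mul]
  have e1 : t * y = t * (y - 1 / 2) + t / 2 := by ring
  have e2 : t * (y - 1) = t * (y - 1 / 2) - t / 2 := by ring
  rw [e1, e2, sin_add, sin_sub]
  field_simp; ring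

lemma Bspline_eq (n : ℕ) (x : ℝ) :
    Bspline (n + 2) x = (1 / (2 * π)) *
      ∫ t : ℝ, cos (t * (x - ((n + 2 : ℕ) : ℝ) / 2)) * sinc (t / 2) ^ (n + 2) := by
  induction n generalizing x with
  | zero => rw [Bspline_two_eq]; norm_num
  | succ n ih =>
    rw [Bspline_succ (n + 1) x]
    simp_rw [ih]
    rw [intervalIntegral.integral_const_mul, intervalIntegral_integral_swap]
    · congr 2
      funext t
      rw [intervalIntegral.integral_mul_const]
      have := integral_cos_shift t (x - ((n + 2 : ℕ) : ℝ) / 2)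
      have h2 := intervalIntegral.integral_comp_sub_right (a := x - 1) (b := x) (fun s => cos (t * s))
        (((n + 2 : ℕ) : ℝ) / 2)
      rw [h2, sub_right_comm, this, pow_succ _ (n + 2)]
      have e : x - ((n + 2 : ℕ) : ℝ) / 2 - 1 / 2 = x - ((n + 1 + 2 : ℕ) : ℝ) / 2 := by
        push_cast; ring
      rw [e]; ring
    · have h1 : Integrable (fun _ : ℝ => (1 : ℝ)) (volume.restrict (Set.uIoc (x - 1) x)) := by
        rw [Set.uIoc_of_le (by linarith)]
        exact integrable_const _
      refine (h1.mul_prod (sinc_integrable_pow (n + 2) (by omega))).mono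
        (by unfold Function.uncurry; fun_prop : Continuous _).aestronglyMeasurable
        (Eventually.of_forall fun p => ?_)
      simp only [Function.uncurry, norm_mul]
      rw [norm_one]
      gcongr
      exact abs_cos_le_one _
lemma sinc_half_weight (k d : ℕ) (hd : 2 * (k + 1) ≤ d) (t : ℝ) :
    |sinc (t / 2) ^ d| * (1 + t ^ 2) ^ (k + 1) ≤ 16 ^ (k + 1) := by
  have h := sinc_pow_bound (k + 1) d (by omega) hd (t / 2)
  have hp : (1 : ℝ) ≤ d / (2 * ((k + 1 : ℕ) : ℝ)) := by
    rw [le_div_iff₀ (by positivity), one_mul]; exact_mod_cast hd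
  set p : ℝ := d / (2 * ((k + 1 : ℕ) : ℝ))
  have h1 : (1 + t ^ 2) ^ (k + 1) ≤ 16 ^ (k + 1) * (1 + (t / 2) ^ 2 / 4 * p) ^ (k + 1) := by
    rw [← mul_pow]
    gcongr
    nlinarith [mul_le_mul_of_nonneg_left hp (sq_nonneg t)]
  calc _ ≤ |sinc (t / 2) ^ d| * (16 ^ (k + 1) * (1 + (t / 2) ^ 2 / 4 * p) ^ (k + 1)) := by gcongr
    _ = 16 ^ (k + 1) * (|sinc (t / 2) ^ d| * (1 + (t / 2) ^ 2 / 4 * p) ^ (k + 1)) := by ring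
    _ ≤ 16 ^ (k + 1) * 1 := by gcongr
    _ = _ := mul_one _

lemma sinc_scaled_weight (k d : ℕ) (hd : 2 * (k + 1) ≤ d) (u : ℝ) :
    |sinc (u / (2 * √((d : ℝ) / 12))) ^ d| * (1 + u ^ 2) ^ (k + 1)
      ≤ (3 * ((k + 1 : ℕ) : ℝ)) ^ (k + 1) := by
  set v := u / (2 * √((d : ℝ) / 12)) with hv
  have h := sinc_pow_bound (k + 1) d (by omega) hd v
  have hd0 : (0 : ℝ) < d := by exact_mod_cast (by omega : 0 < d)
  have hn1 : (1 : ℝ) ≤ ((k + 1 : ℕ) : ℝ) := by exact_mod_cast (by omega : 1 ≤ k + 1)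
  have e : v ^ 2 / 4 * (d / (2 * ((k + 1 : ℕ) : ℝ))) = 3 * u ^ 2 / (8 * ((k + 1 : ℕ) : ℝ)) := by
    rw [hv, div_pow, mul_pow, sq_sqrt (by positivity)]
    generalize ((k + 1 : ℕ) : ℝ) = n at *
    field_simp; ring
  rw [e] at h
  generalize ((k + 1 : ℕ) : ℝ) = n at *
  have h1 : (1 + u ^ 2) ^ (k + 1) ≤ (3 * n) ^ (k + 1) * (1 + 3 * u ^ 2 / (8 * n)) ^ (k + 1) := by
    rw [← mul_pow]
    gcongr
    have : 3 * n * (1 + 3 * u ^ 2 / (8 * n)) = 3 * n + 9 / 8 * u ^ 2 := by field_simp; ring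
    rw [this]; nlinarith [sq_nonneg u]
  calc _ ≤ |sinc v ^ d| * ((3 * n) ^ (k + 1) * (1 + 3 * u ^ 2 / (8 * n)) ^ (k + 1)) := by gcongr
    _ = (3 * n) ^ (k + 1) * (|sinc v ^ d| * (1 + 3 * u ^ 2 / (8 * n)) ^ (k + 1)) := by ring
    _ ≤ (3 * n) ^ (k + 1) * 1 := by gcongr
    _ = _ := mul_one _

lemma scaled_deriv_eq (k d : ℕ) (hd : 2 * (k + 1) ≤ d) (x : ℝ) :
    ((d : ℝ) / 12) ^ (((k : ℝ) + 1) / 2) *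
        iteratedDeriv k (Bspline d) (Real.sqrt ((d : ℝ) / 12) * x + (d : ℝ) / 2)
      = (1 / (2 * π)) * ∫ u : ℝ, u ^ k * cos (u * x + k * (π / 2)) *
          sinc (u / (2 * √((d : ℝ) / 12))) ^ d := by
  have hd0 : (0 : ℝ) < d := by exact_mod_cast (by omega : 0 < d)
  have hB : Bspline d = fun x => (1 / (2 * π)) *
      ∫ t : ℝ, cos (t * (x - (d : ℝ) / 2)) * sinc (t / 2) ^ d := by
    obtain ⟨n, rfl⟩ : ∃ n, d = n + 2 := ⟨d - 2, by omega⟩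
    funext x
    exact Bspline_eq n x
  rw [hB, iteratedDeriv_const_mul_field, iteratedDeriv_cosInt (by fun_prop)
    (sinc_half_weight k d hd) _ k le_rfl]
  have hpow : ((d : ℝ) / 12) ^ (((k : ℝ) + 1) / 2) = √((d : ℝ) / 12) ^ (k + 1) := by
    rw [sqrt_eq_rpow, ← rpow_natCast, ← rpow_mul (by positivity)]
    congr 1; push_cast; ring
  rw [hpow]
  have hs : 0 < √((d : ℝ) / 12) := by positivity
  generalize √((d : ℝ) / 12) = s at *
  have := Measure.integral_comp_mul_left (fun u : ℝ => u ^ k * cos (u * x + k * (π / 2)) *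
          sinc (u / (2 * s)) ^ d) s
  rw [abs_of_pos (by positivity), smul_eq_mul, inv_mul_eq_div, eq_div_iff hs.ne'] at this
  rw [← this, mul_left_comm, mul_comm (∫ _, _) s, pow_succ, mul_comm (s ^ k) s, mul_assoc s,
    ← integral_const_mul]
  congr 3
  funext t
  have e1 : t * (s * x + (d : ℝ) / 2 - (d : ℝ) / 2) = s * t * x := by ring
  have e2 : s * t / (2 * s) = t / 2 := by field_simp
  rw [e1, e2, mul_pow]; ring

theorem bspline_deriv_gaussian_pointwise_limit (k : ℕ) (x : ℝ) :
    Tendsto (fun d : ℕ => ((d : ℝ) / 12) ^ (((k : ℝ) + 1) / 2) *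
        iteratedDeriv k (Bspline d) (Real.sqrt ((d : ℝ) / 12) * x + (d : ℝ) / 2))
      atTop
      (nhds ((1 / Real.sqrt (2 * π)) *
        iteratedDeriv k (fun t : ℝ => Real.exp (-(t ^ 2) / 2)) x)) := by
  have hw : ∀ u : ℝ, |exp (-(u ^ 2) / 2)| * (1 + u ^ 2) ^ (k + 1)
      ≤ (3 * ((k + 1 : ℕ) : ℝ)) ^ (k + 1) := by
    intro u
    refine le_of_tendsto ((tendsto_sinc_pow u).abs.mul_const _) ?_
    filter_upwards [eventually_ge_atTop (2 * (k + 1))] with d hd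
    exact sinc_scaled_weight k d hd u
  have hG : (fun t : ℝ => Real.exp (-(t ^ 2) / 2)) = fun t => (1 / √(2 * π)) *
      ∫ u : ℝ, cos (u * (t - 0)) * exp (-(u ^ 2) / 2) := by
    funext t
    rw [gauss_cosInt, ← mul_assoc, one_div, inv_mul_cancel₀ (by positivity), one_mul]
  have hR : (1 / Real.sqrt (2 * π)) * iteratedDeriv k (fun t : ℝ => Real.exp (-(t ^ 2) / 2)) x
      = (1 / (2 * π)) * ∫ u : ℝ, u ^ k * cos (u * x + k * (π / 2)) * exp (-(u ^ 2) / 2) := by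
    rw [hG, iteratedDeriv_const_mul_field, iteratedDeriv_cosInt (by fun_prop) hw _ k le_rfl,
      ← mul_assoc, div_mul_div_comm, mul_self_sqrt (by positivity), one_mul]
    simp only [sub_zero]
  rw [hR]
  have hL : (fun d : ℕ => (1 / (2 * π)) * ∫ u : ℝ, u ^ k * cos (u * x + k * (π / 2)) *
          sinc (u / (2 * √((d : ℝ) / 12))) ^ d) =ᶠ[atTop]
      (fun d : ℕ => ((d : ℝ) / 12) ^ (((k : ℝ) + 1) / 2) *
        iteratedDeriv k (Bspline d) (Real.sqrt ((d : ℝ) / 12) * x + (d : ℝ) / 2)) := by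
    filter_upwards [eventually_ge_atTop (2 * (k + 1))] with d hd
    exact (scaled_deriv_eq k d hd x).symm
  refine Tendsto.congr' hL (Tendsto.const_mul _ ?_)
  refine tendsto_integral_filter_of_dominated_convergence
    (fun u => (3 * ((k + 1 : ℕ) : ℝ)) ^ (k + 1) * (1 + u ^ 2)⁻¹) ?_ ?_
    (weight_integrable hw k le_rfl).1 ?_
  · exact Eventually.of_forall fun d => (by fun_prop : Continuous _).aestronglyMeasurable
  · filter_upwards [eventually_ge_atTop (2 * (k + 1))] with d hd
    refine Eventually.of_forall fun u => ?_
    refine le_trans ?_ ((weight_integrable (sinc_scaled_weight k d hd) k le_rfl).2 u)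
    rw [norm_mul, norm_mul, norm_pow]
    simp only [Real.norm_eq_abs]
    gcongr
    exact mul_le_of_le_one_right (by positivity) (abs_cos_le_one _)
  · exact Eventually.of_forall fun u => (tendsto_sinc_pow u).const_mul _
end

section
/- There exists a constant C > 0 such that for every integer d ≥ 2 and every real x, |√(d/12) · B_d(√(d/12)·x + d/2) − (1/√(2π)) · exp(−x²/2)| ≤ C/d. -/
open MeasureTheory Real Filter Finset

lemma nonneg_of_deriv {f f' : ℝ → ℝ} (hf : ∀ x, HasDerivAt f (f' x) x) (h0 : f 0 = 0)
    (h : ∀ x, 0 ≤ x → 0 ≤ f' x) (x : ℝ) (hx : 0 ≤ x) : 0 ≤ f x := by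
  have : MonotoneOn f (Set.Ici 0) := by
    apply monotoneOn_of_deriv_nonneg (convex_Ici 0)
    · exact fun x _ => (hf x).continuousAt.continuousWithinAt
    · exact fun x _ => (hf x).differentiableAt.differentiableWithinAt
    · intro x hx
      rw [(hf x).deriv]
      simp at hx
      exact h x hx.le
  have := this (Set.mem_Ici.2 le_rfl) (Set.mem_Ici.2 hx) hx
  linarith

lemma cos_le_quartic (x : ℝ) (hx : 0 ≤ x) : 0 ≤ 1 - x ^ 2 / 2 + x ^ 4 / 24 - cos x := by
  refine nonneg_of_deriv (f := fun x => 1 - x ^ 2 / 2 + x ^ 4 / 24 - cos x)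
    (f' := fun x => sin x - (x - x ^ 3 / 6)) ?_ (by simp) ?_ x hx
  · intro x
    have h := ((((hasDerivAt_const x (1:ℝ)).sub ((hasDerivAt_pow 2 x).div_const 2)).add
      ((hasDerivAt_pow 4 x).div_const 24)).sub (hasDerivAt_cos x))
    refine HasDerivAt.congr_deriv (f := fun x => 1 - x ^ 2 / 2 + x ^ 4 / 24 - cos x) h ?_
    norm_num
    try ring
  · intro x hx
    have := sin_ge_sub_cube hx
    linarith

lemma sin_le_quintic (x : ℝ) (hx : 0 ≤ x) : 0 ≤ x - x ^ 3 / 6 + x ^ 5 / 120 - sin x := by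
  refine nonneg_of_deriv (f := fun x => x - x ^ 3 / 6 + x ^ 5 / 120 - sin x)
    (f' := fun x => 1 - x ^ 2 / 2 + x ^ 4 / 24 - cos x) ?_ (by simp) ?_ x hx
  · intro x
    have h := ((((hasDerivAt_id x)).sub ((hasDerivAt_pow 3 x).div_const 6)).add
      ((hasDerivAt_pow 5 x).div_const 120)).sub (hasDerivAt_sin x)
    refine HasDerivAt.congr_deriv (f := fun x => x - x ^ 3 / 6 + x ^ 5 / 120 - sin x) h ?_
    norm_num
    try ring
  · exact cos_le_quartic

lemma sinc_upper (v : ℝ) : sinc v ≤ 1 - v ^ 2 / 6 + v ^ 4 / 120 := by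
  wlog hv : 0 ≤ v generalizing v
  · have := this (-v) (by linarith)
    rw [sinc_neg] at this
    convert this using 3 <;> ring
  rcases hv.eq_or_lt with rfl | hv
  · simp
  rw [sinc_of_ne_zero hv.ne', div_le_iff₀ hv]
  have := sin_le_quintic v hv.le
  linarith

lemma sinc_lower (v : ℝ) : 1 - v ^ 2 / 6 ≤ sinc v := by
  wlog hv : 0 ≤ v generalizing v
  · have := this (-v) (by linarith)
    rw [sinc_neg] at this
    convert this using 3
    ring
  rcases hv.eq_or_lt with rfl | hv
  · simp
  rw [sinc_of_ne_zero hv.ne', le_div_iff₀ hv]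
  have := sin_ge_sub_cube hv.le
  linarith

lemma abs_sinc_le_inv (v : ℝ) (hv : v ≠ 0) : |sinc v| ≤ |v|⁻¹ := by
  rw [sinc_of_ne_zero hv, abs_div, ← one_div]
  gcongr
  exact abs_sin_le_one v

lemma exp_bounds (z : ℝ) (h0 : 0 ≤ z) (h1 : z ≤ 2 / 3) :
    1 - z + 3 / 10 * z ^ 2 ≤ exp (-z) ∧ exp (-z) ≤ 1 - z + z ^ 2 / 2 := by
  have h := Real.exp_bound (x := -z) (n := 4) (by rw [abs_neg, abs_of_nonneg h0]; linarith) (by norm_num)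
  simp [Finset.sum_range_succ, Nat.factorial] at h
  rw [abs_of_nonneg h0, abs_le] at h
  obtain ⟨ha, hb⟩ := h
  have hz3 : z ^ 3 ≤ 2 / 3 * z ^ 2 := by nlinarith [sq_nonneg z]
  have hz4 : z ^ 4 ≤ 2 / 3 * z ^ 3 := by nlinarith [pow_nonneg h0 3]
  have := pow_nonneg h0 2
  have := pow_nonneg h0 3
  constructor <;> nlinarith

lemma sinc_near (v : ℝ) (hv : |v| ≤ 2) :
    0 ≤ sinc v ∧ sinc v ≤ exp (-(v ^ 2 / 6)) ∧ exp (-(v ^ 2 / 6)) - sinc v ≤ v ^ 4 / 72 := by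
  have h4 : v ^ 2 ≤ 4 := by
    rw [← sq_abs]; nlinarith [abs_nonneg v]
  have hl := sinc_lower v
  have hu := sinc_upper v
  obtain ⟨h1, h2⟩ := exp_bounds (v ^ 2 / 6) (by positivity) (by linarith)
  refine ⟨by linarith, ?_, ?_⟩
  · nlinarith
  · nlinarith

lemma pow_diff (d : ℕ) (hd : 2 ≤ d) (v : ℝ) :
    |sinc v ^ d - exp (-(d * v ^ 2 / 6))| ≤
      d * (v ^ 4 * exp (-(d / 12) * v ^ 2)) + 8 * (1 / 2 : ℝ) ^ d * (1 + v ^ 2)⁻¹ := by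
  have hd' : (2:ℝ) ≤ d := by exact_mod_cast hd
  have hexp : exp (-(d * v ^ 2 / 6)) = exp (-(v ^ 2 / 6)) ^ d := by
    rw [← exp_nat_mul]; congr 1; ring
  rcases le_or_gt |v| 2 with hv | hv
  · obtain ⟨h0, h1, h2⟩ := sinc_near v hv
    have h := abs_pow_sub_pow_le (sinc v) (exp (-(v ^ 2 / 6))) d
    rw [hexp]
    have hm : max |sinc v| |exp (-(v ^ 2 / 6))| = exp (-(v ^ 2 / 6)) := by
      rw [abs_of_nonneg h0, abs_of_pos (exp_pos _), max_eq_right h1]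
    rw [hm] at h
    have ha : |sinc v - exp (-(v ^ 2 / 6))| ≤ v ^ 4 := by
      rw [abs_le]; constructor <;> nlinarith [sq_nonneg (v^2)]
    have hb : exp (-(v ^ 2 / 6)) ^ (d - 1) ≤ exp (-(d / 12) * v ^ 2) := by
      rw [← exp_nat_mul]
      apply exp_le_exp.2
      rw [Nat.cast_sub (by omega)]
      push_cast
      nlinarith [sq_nonneg v]
    calc _ ≤ |sinc v - exp (-(v ^ 2 / 6))| * d * exp (-(v ^ 2 / 6)) ^ (d - 1) := h
      _ ≤ v ^ 4 * d * exp (-(d / 12) * v ^ 2) := by gcongr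
      _ = d * (v ^ 4 * exp (-(d / 12) * v ^ 2)) := by ring
      _ ≤ _ := by
        have : 0 ≤ 8 * (1 / 2 : ℝ) ^ d * (1 + v ^ 2)⁻¹ := by positivity
        linarith
  · have hv0 : v ≠ 0 := by
      rintro rfl
      norm_num at hv
    have h4 : 4 ≤ v ^ 2 := by
      rw [← sq_abs]; nlinarith [abs_nonneg v]
    have h1 : |sinc v ^ d| ≤ 8 * (1 / 2 : ℝ) ^ d * (1 + v ^ 2)⁻¹ := by
      obtain ⟨k, rfl⟩ := Nat.exists_eq_add_of_le hd
      have hi : |v|⁻¹ ≤ 1 / 2 := by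
        rw [one_div]; gcongr
      rw [abs_pow]
      calc |sinc v| ^ (2 + k) ≤ (|v|⁻¹) ^ (2 + k) := by
            gcongr; exact abs_sinc_le_inv v hv0
        _ = (v ^ 2)⁻¹ * (|v|⁻¹) ^ k := by rw [pow_add, inv_pow, sq_abs]
        _ ≤ (2 * (1 + v ^ 2)⁻¹) * (1 / 2) ^ k := by
            gcongr
            rw [← div_eq_mul_inv, ← one_div, div_le_div_iff₀ (by positivity) (by positivity)]
            linarith
        _ = _ := by rw [pow_add]; ring
    have h2 : exp (-(d * v ^ 2 / 6)) ≤ d * (v ^ 4 * exp (-(d / 12) * v ^ 2)) := by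
      have : exp (-(d * v ^ 2 / 6)) ≤ exp (-(d / 12) * v ^ 2) := by
        apply exp_le_exp.2
        nlinarith [sq_nonneg v]
      have h16 : 1 ≤ v ^ 4 := by nlinarith
      have h3 : 1 ≤ d * v ^ 4 := by nlinarith
      calc _ ≤ 1 * exp (-(d / 12) * v ^ 2) := by rw [one_mul]; exact this
        _ ≤ (d * v ^ 4) * exp (-(d / 12) * v ^ 2) := by gcongr
        _ = _ := by ring
    calc _ ≤ |sinc v ^ d| + |exp (-(d * v ^ 2 / 6))| := abs_sub _ _
      _ ≤ _ := by rw [abs_of_pos (exp_pos (-(d * v ^ 2 / 6)))]; linarith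

lemma integrable_sinc_pow (d : ℕ) (hd : 2 ≤ d) : Integrable (fun v => sinc v ^ d) := by
  refine Integrable.mono' (g := fun v => 2 * (1 + v ^ 2)⁻¹)
    (integrable_inv_one_add_sq.const_mul 2) (continuous_sinc.pow d).aestronglyMeasurable ?_
  refine Eventually.of_forall fun v => ?_
  rw [norm_pow, Real.norm_eq_abs]
  have h2 : |sinc v| ^ d ≤ |sinc v| ^ 2 := pow_le_pow_of_le_one (abs_nonneg _) (abs_sinc_le_one v) hd
  refine h2.trans ?_
  rw [← div_eq_mul_inv, le_div_iff₀ (by positivity), mul_add, mul_one]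
  have h3 : |sinc v| ^ 2 ≤ 1 := pow_le_one₀ (abs_nonneg _) (abs_sinc_le_one v)
  have h4 : |sinc v| ^ 2 * v ^ 2 ≤ 1 := by
    rcases eq_or_ne v 0 with rfl | hv
    · simp
    · rw [sinc_of_ne_zero hv, sq_abs, div_pow, div_mul_cancel₀ _ (by positivity)]
      exact sin_sq_le_one v
  linarith

lemma bspline_step (d : ℕ) (x : ℝ) :
    Bspline (d + 2) x = ∫ y in (x - 1)..x, Bspline (d + 1) y := by
  rw [Bspline, intervalIntegral.integral_of_le (by linarith), ← integral_indicator measurableSet_Ioc]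
  congr 1
  ext y
  by_cases h : y ∈ Set.Ioc (x - 1) x
  · rw [Set.indicator_of_mem h]
    rw [if_pos ⟨by linarith [h.2], by linarith [h.1]⟩, one_mul]
  · rw [Set.indicator_of_notMem h, if_neg, zero_mul]
    rintro ⟨h1, h2⟩
    exact h ⟨by linarith, by linarith⟩

lemma bspline_two (x : ℝ) : Bspline 2 (x + 1) = max 0 (1 - |x|) := by
  rw [bspline_step 0, intervalIntegral.integral_of_le (by linarith)]
  have h1 : (fun y => Bspline (0 + 1) y) = (Set.Ico (0:ℝ) 1).indicator (fun _ => (1:ℝ)) := by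
    ext y
    simp only [Bspline, Set.indicator, Set.mem_Ico]
  rw [h1, ← integral_indicator measurableSet_Ioc, Set.indicator_indicator,
    integral_indicator_const _ (measurableSet_Ioc.inter measurableSet_Ico), smul_eq_mul, mul_one]
  have h2 : volume.real (Set.Ioc (x + 1 - 1) (x + 1) ∩ Set.Ico (0:ℝ) 1)
      = volume.real (Set.Ioc (x + 1 - 1) (x + 1) ∩ Set.Ioc (0:ℝ) 1) := by
    apply measureReal_congr
    exact (ae_eq_refl _).inter Ico_ae_eq_Ioc
  rw [h2, Set.Ioc_inter_Ioc, Real.volume_real_Ioc, max_comm]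
  congr 1
  rw [add_sub_cancel_right]
  rcases le_total 0 x with h | h
  · rw [abs_of_nonneg h, max_eq_left h, min_eq_right (by linarith)]
  · rw [abs_of_nonpos h, max_eq_right h, min_eq_left (by linarith)]
    ring

lemma hat_cos_integral (a : ℝ) (ha : a ≠ 0) :
    ∫ x, max 0 (1 - |x|) * cos (a * x) = sinc (a / 2) ^ 2 := by
  have h1 : ∫ x, max 0 (1 - |x|) * cos (a * x) = ∫ x in (-1:ℝ)..1, max 0 (1 - |x|) * cos (a * x) := by
    rw [intervalIntegral.integral_of_le (by norm_num), setIntegral_eq_integral_of_forall_compl_eq_zero]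
    intro x hx
    have : 1 ≤ |x| := by
      by_contra! h
      rw [abs_lt] at h
      exact hx ⟨h.1, h.2.le⟩
    rw [max_eq_left (by linarith), zero_mul]
  have hc : Continuous fun x : ℝ => max 0 (1 - |x|) * cos (a * x) := by fun_prop
  rw [h1, ← intervalIntegral.integral_add_adjacent_intervals (b := 0)
    (hc.intervalIntegrable _ _) (hc.intervalIntegrable _ _)]
  have h2 : ∫ x in (-1:ℝ)..0, max 0 (1 - |x|) * cos (a * x)
      = ∫ x in (0:ℝ)..1, max 0 (1 - |x|) * cos (a * x) := by
    have := intervalIntegral.integral_comp_neg (a := 0) (b := 1)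
      (fun x : ℝ => max 0 (1 - |x|) * cos (a * x))
    rw [neg_zero] at this
    rw [← this]
    simp
  have h3 : ∫ x in (0:ℝ)..1, max 0 (1 - |x|) * cos (a * x) = (1 - cos a) / a ^ 2 := by
    have hd : ∀ x ∈ Set.uIcc (0:ℝ) 1,
        HasDerivAt (fun x => (1 - x) * (sin (a * x) / a) - cos (a * x) / a ^ 2)
        ((1 - x) * cos (a * x)) x := by
      intro x _
      have hl : HasDerivAt (fun x => a * x) a x := by simpa using (hasDerivAt_id x).const_mul a
      have := (((hasDerivAt_id x).const_sub 1).mul (hl.sin.div_const a)).sub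
        (hl.cos.div_const (a ^ 2))
      refine HasDerivAt.congr_deriv this ?_
      simp only [id]
      field_simp
      ring
    have := intervalIntegral.integral_eq_sub_of_hasDerivAt hd
      ((by fun_prop : Continuous fun x : ℝ => (1 - x) * cos (a * x)).intervalIntegrable _ _)
    have h4 : ∫ x in (0:ℝ)..1, max 0 (1 - |x|) * cos (a * x)
        = ∫ x in (0:ℝ)..1, (1 - x) * cos (a * x) := by
      apply intervalIntegral.integral_congr
      intro x hx
      rw [Set.uIcc_of_le (by norm_num)] at hx
      simp only
      rw [abs_of_nonneg hx.1, max_eq_right (by linarith [hx.2])]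
    rw [h4, this]
    simp
    ring
  rw [h2, h3, sinc_of_ne_zero (by positivity), div_pow, sin_sq_eq_half_sub,
    show 2 * (a / 2) = a by ring]
  field_simp
  ring

lemma hat_integrable : Integrable (fun x : ℝ => max 0 (1 - |x|)) := by
  refine Continuous.integrable_of_hasCompactSupport (by fun_prop) ?_
  refine HasCompactSupport.of_support_subset_isCompact (K := Set.Icc (-1) 1) isCompact_Icc ?_
  intro x hx
  rw [Set.mem_Icc, ← abs_le]
  by_contra! h
  exact hx (max_eq_left (by linarith))

lemma integral_cexp_even (g : ℝ → ℝ) (hg : Integrable g) (he : ∀ x, g (-x) = g x) (c : ℝ) :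
    ∫ x : ℝ, Complex.exp ((c * x : ℝ) * Complex.I) * (g x : ℂ) = ((∫ x, g x * cos (c * x) : ℝ) : ℂ) := by
  have hb : ∀ h : ℝ → ℝ, Continuous h → (∀ x, |h x| ≤ 1) → Integrable fun x => g x * h x := by
    intro h hc h1
    refine hg.mul_bdd (c := 1) hc.aestronglyMeasurable (Eventually.of_forall h1)
  have hcos := hb (fun x => cos (c * x)) (by fun_prop) (fun x => abs_cos_le_one _)
  have hsin := hb (fun x => sin (c * x)) (by fun_prop) (fun x => abs_sin_le_one _)
  have hodd : ∫ x, g x * sin (c * x) = 0 := by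
    have := integral_neg_eq_self (fun x => g x * sin (c * x)) volume
    simp only [he, mul_neg, sin_neg, integral_neg] at this
    linarith
  have : (fun x : ℝ => Complex.exp ((c * x : ℝ) * Complex.I) * (g x : ℂ))
      = fun x : ℝ => ((g x * cos (c * x) : ℝ) : ℂ) + ((g x * sin (c * x) : ℝ) : ℂ) * Complex.I := by
    ext x
    rw [Complex.exp_mul_I, ← Complex.ofReal_cos, ← Complex.ofReal_sin]
    push_cast
    ring
  rw [this, integral_add hcos.ofReal (hsin.ofReal.mul_const _), integral_mul_const,
    integral_complex_ofReal, integral_complex_ofReal, hodd]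
  simp

open FourierTransform in
lemma hat_inversion (x : ℝ) :
    max 0 (1 - |x|) = (1 / π) * ∫ v, sinc v ^ 2 * cos (2 * v * x) := by
  set f : ℝ → ℂ := fun x => ((max 0 (1 - |x|) : ℝ) : ℂ) with hf
  have hcont : Continuous f := by
    rw [hf]; fun_prop
  have hint : Integrable f := hat_integrable.ofReal
  have hF : 𝓕 f =ᵐ[volume] fun w => ((sinc (π * w) ^ 2 : ℝ) : ℂ) := by
    have h0 : ∀ᵐ w : ℝ, w ≠ 0 := by
      simp [ae_iff]
    filter_upwards [h0] with w hw
    rw [Real.fourier_real_eq_integral_exp_smul]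
    have h1 := integral_cexp_even _ hat_integrable (by simp) (-2 * π * w)
    rw [hat_cos_integral _ (by simp [hw, pi_ne_zero]), show -2 * π * w / 2 = -(π * w) by ring,
      sinc_neg] at h1
    rw [← h1]
    congr 1
    ext v
    rw [smul_eq_mul, hf]
    congr 4
    ring
  have hsI : Integrable (fun w => sinc (π * w) ^ 2) :=
    (integrable_sinc_pow 2 le_rfl).comp_mul_left' pi_ne_zero
  have hFi : Integrable (𝓕 f) := hsI.ofReal.congr hF.symm
  have hinv := congrFun (hcont.fourierInv_fourier_eq hint hFi) x
  rw [Real.fourierInv_eq'] at hinv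
  have h2 : ∫ v : ℝ, Complex.exp ((↑(2 * π * inner ℝ v x) * Complex.I)) • 𝓕 f v
      = ∫ v : ℝ, Complex.exp ((2 * π * x * v : ℝ) * Complex.I) * ((sinc (π * v) ^ 2 : ℝ) : ℂ) := by
    apply integral_congr_ae
    filter_upwards [hF] with v hv
    rw [hv, smul_eq_mul]
    congr 4
    simp
    ring
  rw [h2, integral_cexp_even _ hsI (by intro x; rw [mul_neg, sinc_neg])] at hinv
  have h3 : ∫ v, sinc (π * v) ^ 2 * cos (2 * π * x * v) = max 0 (1 - |x|) := by
    exact Complex.ofReal_injective hinv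
  rw [← h3]
  have := Measure.integral_comp_mul_left (fun v => sinc v ^ 2 * cos (2 * v * x)) π
  rw [smul_eq_mul, abs_of_pos (by positivity)] at this
  rw [one_div, ← this]
  congr 1
  ext v
  congr 2
  ring

lemma cos_window (x v : ℝ) :
    ∫ y in (x - 1 / 2)..(x + 1 / 2), cos (2 * v * y) = sinc v * cos (2 * v * x) := by
  rcases eq_or_ne v 0 with rfl | hv
  · simp; norm_num
  rw [intervalIntegral.integral_comp_mul_left (fun y => cos y) (by positivity), integral_cos,
    sinc_of_ne_zero hv, show 2 * v * (x + 1 / 2) = 2 * v * x + v by ring,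
    show 2 * v * (x - 1 / 2) = 2 * v * x - v by ring, sin_add, sin_sub, smul_eq_mul]
  field_simp
  ring

lemma bspline_fourier (d : ℕ) (x : ℝ) :
    Bspline (d + 2) (x + ((d : ℝ) + 2) / 2) =
      (1 / π) * ∫ v, sinc v ^ (d + 2) * cos (2 * v * x) := by
  induction d generalizing x with
  | zero => simpa using (bspline_two x).trans (hat_inversion x)
  | succ d ih =>
    rw [bspline_step (d + 1)]
    have h1 : ∫ y in (x + (((d + 1 : ℕ) : ℝ) + 2) / 2 - 1)..(x + (((d + 1 : ℕ) : ℝ) + 2) / 2),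
        Bspline (d + 1 + 1) y = ∫ y in (x - 1 / 2)..(x + 1 / 2),
          Bspline (d + 2) (y + ((d : ℝ) + 2) / 2) := by
      rw [intervalIntegral.integral_comp_add_right (fun y => Bspline (d + 2) y)]
      congr 1 <;> push_cast <;> ring
    rw [h1]
    simp_rw [ih]
    rw [intervalIntegral.integral_const_mul, intervalIntegral_integral_swap]
    · congr 2
      ext v
      rw [intervalIntegral.integral_const_mul, cos_window]
      ring
    · have hi : Integrable (Function.uncurry fun (_ : ℝ) (v : ℝ) => sinc v ^ (d + 2))
          ((volume.restrict (Set.uIoc (x - 1 / 2) (x + 1 / 2))).prod volume) := by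
        have : IsFiniteMeasure (volume.restrict (Set.uIoc (x - 1 / 2) (x + 1 / 2))) :=
          ⟨by simp [Set.uIoc]⟩
        have := (integrable_const (μ := volume.restrict (Set.uIoc (x - 1 / 2) (x + 1 / 2)))
          (1:ℝ)).mul_prod (integrable_sinc_pow (d + 2) (by omega))
        simp only [one_mul] at this
        exact this
      refine hi.mul_bdd (c := 1) (g := fun p : ℝ × ℝ => cos (2 * p.2 * p.1)) ?_ ?_
      · exact (by fun_prop : Continuous fun p : ℝ × ℝ => cos (2 * p.2 * p.1)).aestronglyMeasurable
      · exact Eventually.of_forall fun p => abs_cos_le_one _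

lemma gaussian_fourier (b : ℝ) (hb : 0 < b) (t : ℝ) :
    ∫ v, exp (-b * v ^ 2) * cos (t * v) = sqrt (π / b) * exp (-t ^ 2 / (4 * b)) := by
  have h := fourierIntegral_gaussian (b := (b : ℂ)) (by simpa using hb) (t : ℂ)
  have h2 := integral_cexp_even (fun v => exp (-b * v ^ 2)) (integrable_exp_neg_mul_sq hb)
    (by simp) t
  have h3 : ((∫ v, exp (-b * v ^ 2) * cos (t * v) : ℝ) : ℂ)
      = ((sqrt (π / b) * exp (-t ^ 2 / (4 * b)) : ℝ) : ℂ) := by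
    rw [← h2, sqrt_eq_rpow]
    rw [Complex.ofReal_mul, Complex.ofReal_cpow (by positivity)]
    push_cast
    rw [← h]
    congr 1
    ext v
    congr 2
    ring
  exact_mod_cast h3

lemma integrable_quartic (b : ℝ) (hb : 0 < b) : Integrable fun v : ℝ => v ^ 4 * exp (-b * v ^ 2) := by
  have := integrable_rpow_mul_exp_neg_mul_sq hb (s := ((4 : ℕ) : ℝ)) (by norm_num)
  simpa only [rpow_natCast] using this

lemma quartic_moment (d : ℝ) (hd : 0 < d) :
    ∫ v : ℝ, v ^ 4 * exp (-(d / 12) * v ^ 2) =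
      (d ^ 2 * sqrt d)⁻¹ * ∫ v : ℝ, v ^ 4 * exp (-(1 / 12) * v ^ 2) := by
  have := Measure.integral_comp_mul_left (fun v : ℝ => v ^ 4 * exp (-(1 / 12) * v ^ 2)) (sqrt d)
  have hs : sqrt d ^ 2 = d := sq_sqrt hd.le
  have h2 : (fun v : ℝ => (sqrt d * v) ^ 4 * exp (-(1 / 12) * (sqrt d * v) ^ 2))
      = fun v => d ^ 2 * (v ^ 4 * exp (-(d / 12) * v ^ 2)) := by
    ext v
    rw [mul_pow, mul_pow, show sqrt d ^ 4 = (sqrt d ^ 2) ^ 2 by ring, hs, mul_assoc]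
    congr 3
    ring
  rw [h2, integral_const_mul, smul_eq_mul, abs_of_pos (by positivity)] at this
  rw [mul_inv, mul_assoc, ← this, ← mul_assoc, inv_mul_cancel₀ (by positivity), one_mul]

lemma sq_le_two_pow (d : ℕ) : (d : ℝ) ^ 2 ≤ 2 * 2 ^ d := by
  have h : ∀ d : ℕ, d ^ 2 ≤ 2 * 2 ^ d ∧ 2 * d + 1 ≤ 2 * 2 ^ d := by
    intro d
    rcases lt_or_ge d 3 with h | h
    · interval_cases d <;> norm_num
    · induction d, h using Nat.le_induction with
      | base => norm_num
      | succ n hn ih =>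
        rw [pow_succ 2 n]
        constructor <;> nlinarith [ih.1, ih.2]
  exact_mod_cast (h d).1

theorem bspline_gaussian_rate :
    ∃ C : ℝ, 0 < C ∧ ∀ d : ℕ, 2 ≤ d → ∀ x : ℝ,
      |Real.sqrt ((d : ℝ) / 12) * Bspline d (Real.sqrt ((d : ℝ) / 12) * x + (d : ℝ) / 2) -
        (1 / Real.sqrt (2 * π)) * Real.exp (-(x ^ 2) / 2)| ≤ C / d := by
  set K : ℝ := ∫ v : ℝ, v ^ 4 * exp (-(1 / 12) * v ^ 2) with hK
  have hK0 : 0 ≤ K := integral_nonneg fun v => by positivity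
  refine ⟨K + 16 * π, by positivity, fun d hd x => ?_⟩
  have hd' : (2:ℝ) ≤ d := by exact_mod_cast hd
  have hd0 : (0:ℝ) < d := by linarith
  set σ := sqrt ((d:ℝ) / 12) with hσ
  have hσ2 : σ ^ 2 = d / 12 := sq_sqrt (by positivity)
  have hσ0 : 0 < σ := by positivity
  have hB : Bspline d (σ * x + (d : ℝ) / 2) = (1 / π) * ∫ v, sinc v ^ d * cos (2 * σ * x * v) := by
    obtain ⟨k, rfl⟩ := Nat.exists_eq_add_of_le' hd
    have := bspline_fourier k (σ * x)
    push_cast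
    rw [this]
    congr 2
    ext v
    congr 2
    ring
  have hG : (1 / sqrt (2 * π)) * exp (-(x ^ 2) / 2)
      = σ * ((1 / π) * ∫ v, exp (-(d / 6) * v ^ 2) * cos (2 * σ * x * v)) := by
    rw [gaussian_fourier _ (by positivity)]
    have e1 : -(2 * σ * x) ^ 2 / (4 * ((d:ℝ) / 6)) = -(x ^ 2) / 2 := by
      rw [mul_pow, mul_pow, hσ2]
      field_simp
      ring
    have e2 : 1 / sqrt (2 * π) = σ * (1 / π) * sqrt (π / (d / 6)) := by
      rw [hσ, mul_right_comm, ← sqrt_mul (by positivity), eq_comm]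
      rw [show (d:ℝ) / 12 * (π / (d / 6)) = π ^ 2 / (2 * π) by field_simp; norm_num]
      rw [sqrt_div (by positivity), sqrt_sq pi_pos.le]
      field_simp
    rw [e1, e2]
    ring
  have hcos : ∀ g : ℝ → ℝ, Integrable g → Integrable fun v => g v * cos (2 * σ * x * v) := by
    intro g hg
    exact hg.mul_bdd (c := 1) (by fun_prop : Continuous fun v => cos (2 * σ * x * v)).aestronglyMeasurable
      (Eventually.of_forall fun v => abs_cos_le_one _)
  have hi1 := hcos _ (integrable_sinc_pow d hd)
  have hi2 := hcos _ (integrable_exp_neg_mul_sq (b := (d:ℝ) / 6) (by positivity))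
  have hj1 := (integrable_quartic ((d:ℝ) / 12) (by positivity)).const_mul (d:ℝ)
  have hj2 := integrable_inv_one_add_sq.const_mul (8 * (1 / 2 : ℝ) ^ d)
  have hint : |(∫ v, sinc v ^ d * cos (2 * σ * x * v)) -
      ∫ v, exp (-(d / 6) * v ^ 2) * cos (2 * σ * x * v)|
      ≤ d * ((d ^ 2 * sqrt d)⁻¹ * K) + 8 * (1 / 2 : ℝ) ^ d * π := by
    rw [← integral_sub hi1 hi2, hK, ← quartic_moment _ hd0, ← integral_univ_inv_one_add_sq,
      ← integral_const_mul, ← integral_const_mul, ← integral_add hj1 hj2]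
    rw [← Real.norm_eq_abs]
    refine norm_integral_le_of_norm_le (hj1.add hj2) (Eventually.of_forall fun v => ?_)
    have := pow_diff d hd v
    rw [← sub_mul, norm_mul]
    refine (mul_le_of_le_one_right (norm_nonneg _) (abs_cos_le_one _)).trans ?_
    rw [show -((d:ℝ) / 6) * v ^ 2 = -(d * v ^ 2 / 6) by ring]
    exact this
  rw [hB, hG, ← mul_sub, ← mul_sub, abs_mul, abs_mul, abs_of_pos hσ0,
    abs_of_pos (by positivity : 0 < 1 / π)]
  have hpi : 1 / π ≤ 1 := by
    rw [div_le_one pi_pos]; linarith [pi_gt_three]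
  have hσs : σ ≤ sqrt d := sqrt_le_sqrt (by linarith)
  have hsd : sqrt d ≤ d := by
    rw [sqrt_le_left hd0.le]; nlinarith
  have hp : (1 / 2 : ℝ) ^ d ≤ 2 / d ^ 2 := by
    rw [div_pow, one_pow, div_le_div_iff₀ (by positivity) (by positivity)]
    linarith [sq_le_two_pow d]
  have hs0 : 0 < sqrt d := by positivity
  calc _ ≤ sqrt d * (1 * (d * ((d ^ 2 * sqrt d)⁻¹ * K) + 8 * (1 / 2 : ℝ) ^ d * π)) := by
        gcongr
    _ = K / d + sqrt d * (8 * (1 / 2 : ℝ) ^ d * π) := by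
        field_simp
    _ ≤ K / d + d * (8 * (2 / d ^ 2) * π) := by gcongr
    _ = _ := by field_simp; ring
end
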